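/- arXiv:2106.10586 — 3 statements merged into one kernel-verified Lean document; each statement's English description precedes it below -/
import Mathlib

section
/- Let k be a field of characteristic ≠ 2, let n be an odd positive integer, and let A₁,…,Aₙ ∈ k with Aₙ ≠ 0. Let M = M(A₁,…,Aₙ) be the n×n symmetric matrix whose (i,j) entry is A_{i+j−1} if i+j−1 ≤ n and 0 if i+j−1 > n. Then the quadratic form x ↦ xᵀMx on kⁿ is equivalent to the diagonal quadratic form ⟨Aₙ, 1, −1, 1, −1, …, 1, −1⟩, i.e., to the orthogonal sum of ⟨Aₙ⟩ and (n−1)/2 copies of the hyperbolic plane ⟨1,−1⟩. -/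
open Finset in
/-- A symmetric double sum equals its upper triangular part with off-diagonal terms doubled. -/
lemma sum_sum_eq_sum_sum_upper {k : Type*} [Field k] (hchar : (2 : k) ≠ 0) {n : ℕ}
    (f : Fin n → Fin n → k) (hf : ∀ i j, f i j = f j i) :
    ∑ i, ∑ j, f i j = ∑ i, ∑ j, (if i < j then 2 else if i = j then 1 else 0) * f i j := by
  have h : ∑ i, ∑ j, (if i < j then 2 else if i = j then 1 else 0) * f i j =
      ∑ i, ∑ j, (if j < i then 2 else if i = j then 1 else 0) * f i j := by
    rw [sum_comm]
    refine sum_congr rfl fun i _ => sum_congr rfl fun j _ => ?_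
    rw [hf i j]
    simp only [eq_comm]
  apply mul_left_cancel₀ hchar
  conv_rhs => rw [two_mul]
  conv_rhs => enter [2]; rw [h]
  simp only [mul_sum, ← sum_add_distrib]
  refine sum_congr rfl fun i _ => sum_congr rfl fun j _ => ?_
  rcases lt_trichotomy i j with hij | rfl | hij
  · simp [hij, hij.ne, hij.not_gt]
  · simp [two_mul]
  · simp [hij, hij.ne', hij.not_gt]

lemma sum_range_two_mul_add_one {M : Type*} [AddCommMonoid M] (f : ℕ → M) (m : ℕ) :
    ∑ i ∈ Finset.range (2 * m + 1), f i =
      f 0 + ∑ i ∈ Finset.range m, (f (2 * i + 1) + f (2 * i + 2)) := by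
  induction m with
  | zero => simp
  | succ m ih =>
    rw [show 2 * (m + 1) + 1 = 2 * m + 1 + 1 + 1 by ring, Finset.sum_range_succ,
      Finset.sum_range_succ, ih, Finset.sum_range_succ]
    simp only [add_assoc]

section HankelForm

variable {k : Type*} [Field k]

/-- The `i`-th coordinate form on `Fin n → k`, equal to zero when `n ≤ i`. -/
def coordForm (k : Type*) [Field k] (n i : ℕ) : (Fin n → k) →ₗ[k] k :=
  if h : i < n then LinearMap.proj ⟨i, h⟩ else 0

lemma coordForm_val {n : ℕ} (i : Fin n) (x : Fin n → k) : coordForm k n i x = x i := by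
  simp [coordForm]

/-- The linear form `ℓᵢ` collecting the upper triangular part of the `i`-th row of the Hankel
quadratic form with coefficients `a`, so that this form is `∑ xᵢ ℓᵢ`. -/
def hankelRow (a : ℕ → k) (n i : ℕ) : (Fin n → k) →ₗ[k] k :=
  ∑ j : Fin n, ((if i < j then 2 else if i = j then 1 else 0) * a (i + j)) • LinearMap.proj j

lemma hankelRow_apply (a : ℕ → k) (n i : ℕ) (x : Fin n → k) :
    hankelRow a n i x =
      ∑ j : Fin n, (if i < j then 2 else if i = j then 1 else 0) * a (i + j) * x j := by
  simp only [hankelRow, LinearMap.sum_apply, LinearMap.smul_apply, LinearMap.proj_apply,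
    smul_eq_mul]

/-- The change of coordinates turning each product `xᵢ ℓᵢ`, `i < m`, into a difference of
squares. -/
def hankelDiag (a : ℕ → k) (m : ℕ) : (Fin (2 * m + 1) → k) →ₗ[k] (Fin (2 * m + 1) → k) :=
  LinearMap.pi fun i =>
    if (i : ℕ) = 0 then coordForm k _ m
    else if Odd (i : ℕ) then
      (2⁻¹ : k) • (coordForm k _ ((i - 1) / 2) + hankelRow a _ ((i - 1) / 2))
    else (2⁻¹ : k) • (coordForm k _ ((i - 1) / 2) - hankelRow a _ ((i - 1) / 2))

lemma coordForm_hankelDiag_zero (a : ℕ → k) (m : ℕ) (x : Fin (2 * m + 1) → k) :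
    coordForm k _ 0 (hankelDiag a m x) = coordForm k _ m x := by
  simp [coordForm, hankelDiag]

lemma coordForm_hankelDiag_odd (a : ℕ → k) {m i : ℕ} (hi : i < m) (x : Fin (2 * m + 1) → k) :
    coordForm k _ (2 * i + 1) (hankelDiag a m x) =
      2⁻¹ * (coordForm k _ i x + hankelRow a _ i x) := by
  rw [coordForm, dif_pos (by omega)]
  simp [hankelDiag, mul_add]

lemma coordForm_hankelDiag_even (a : ℕ → k) {m i : ℕ} (hi : i < m) (x : Fin (2 * m + 1) → k) :
    coordForm k _ (2 * i + 2) (hankelDiag a m x) =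
      2⁻¹ * (coordForm k _ i x - hankelRow a _ i x) := by
  have h : ¬ Odd (2 * i + 2) := by rw [Nat.not_odd_iff_even]; exact ⟨i + 1, by ring⟩
  have h' : (2 * i + 1) / 2 = i := by omega
  rw [coordForm, dif_pos (by omega)]
  simp [hankelDiag, h, h']

lemma hankelRow_middle {a : ℕ → k} {m : ℕ} (ha : ∀ i, 2 * m < i → a i = 0)
    (x : Fin (2 * m + 1) → k) :
    hankelRow a _ m x = a (2 * m) * coordForm k _ m x := by
  rw [hankelRow_apply, Finset.sum_eq_single ⟨m, by omega⟩]
  · simp [coordForm, two_mul, show m < m + m + 1 by omega]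
  · intro j _ hj
    have hj' : m ≠ j := fun h => hj (Fin.ext h.symm)
    by_cases h : m < j
    · simp [ha (m + j) (by omega)]
    · simp [h, hj']
  · simp

lemma hankelRow_eq_zero {a : ℕ → k} {m i : ℕ} (ha : ∀ i, 2 * m < i → a i = 0) (hi : m < i)
    (x : Fin (2 * m + 1) → k) : hankelRow a _ i x = 0 := by
  rw [hankelRow_apply]
  refine Finset.sum_eq_zero fun j _ => ?_
  by_cases h : i ≤ j
  · simp [ha (i + j) (by omega)]
  · simp [show ¬ i < j by omega, show ¬ i = j by omega]

lemma hankelDiag_injective (hchar : (2 : k) ≠ 0) {a : ℕ → k} {m : ℕ}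
    (ha : ∀ i, 2 * m < i → a i = 0) (ham : a (2 * m) ≠ 0) :
    Function.Injective (hankelDiag a m) := by
  rw [injective_iff_map_eq_zero]
  intro x hx
  have hmid : coordForm k _ m x = 0 := by
    rw [← coordForm_hankelDiag_zero a, hx, map_zero]
  have hlow (i : ℕ) (hi : i < m) : coordForm k _ i x = 0 ∧ hankelRow a _ i x = 0 := by
    have h1 := coordForm_hankelDiag_odd a hi x
    have h2 := coordForm_hankelDiag_even a hi x
    rw [hx, map_zero, eq_comm, mul_eq_zero_iff_left (inv_ne_zero hchar)] at h1 h2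
    constructor <;> apply mul_left_cancel₀ hchar
    · linear_combination h1 + h2
    · linear_combination h1 - h2
  have key (j : ℕ) : ∀ hj : j < 2 * m + 1, x ⟨j, hj⟩ = 0 := by
    induction j using Nat.strong_induction_on with
    | _ j ih =>
      intro hj
      rcases lt_trichotomy j m with h | rfl | h
      · simpa [coordForm, hj] using (hlow j h).1
      · simpa [coordForm, hj] using hmid
      · have hrow := (hlow (2 * m - j) (by omega)).2
        rw [hankelRow_apply, Finset.sum_eq_single ⟨j, hj⟩] at hrow
        · simpa [show 2 * m - j < j by omega, show 2 * m - j + j = 2 * m by omega, hchar, ham]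
            using hrow
        · intro l _ hl
          have hl' : (l : ℕ) ≠ j := fun h => hl (Fin.ext h)
          rcases lt_or_gt_of_ne hl' with h | h
          · simp [ih l h l.2]
          · simp [ha (2 * m - j + l) (by omega)]
        · simp
  exact funext fun i => key i i.2

lemma sum_coordForm_mul_hankelRow (hchar : (2 : k) ≠ 0) {a : ℕ → k} {m : ℕ}
    (ha : ∀ i, 2 * m < i → a i = 0) (x : Fin (2 * m + 1) → k) :
    ∑ i : Fin (2 * m + 1), ∑ j : Fin (2 * m + 1), a (i + j) * (x i * x j) =
      a (2 * m) * coordForm k _ m x ^ 2 +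
        ∑ i ∈ Finset.range m, coordForm k _ i x * hankelRow a _ i x := by
  rw [sum_sum_eq_sum_sum_upper hchar _ fun i j => by rw [add_comm, mul_comm (x i)]]
  trans ∑ i ∈ Finset.range (2 * m + 1), coordForm k _ i x * hankelRow a _ i x
  · rw [Finset.sum_range]
    refine Finset.sum_congr rfl fun i _ => ?_
    rw [coordForm_val, hankelRow_apply, Finset.mul_sum]
    refine Finset.sum_congr rfl fun j _ => ?_
    simp only [Fin.lt_def, Fin.ext_iff]
    ring
  · rw [← Finset.sum_subset (Finset.range_subset_range.2 (show m + 1 ≤ 2 * m + 1 by omega)),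
      Finset.sum_range_succ, hankelRow_middle ha]
    · ring
    · intro i _ hi
      rw [hankelRow_eq_zero ha (by simpa using hi), mul_zero]

lemma weightedSumSquares_hankelDiag (hchar : (2 : k) ≠ 0) {a : ℕ → k} {m : ℕ}
    (ha : ∀ i, 2 * m < i → a i = 0) {w : Fin (2 * m + 1) → k} (hw0 : w 0 = a (2 * m))
    (hw : ∀ i : Fin (2 * m + 1), 0 < (i : ℕ) → w i = if Odd (i : ℕ) then 1 else -1)
    (x : Fin (2 * m + 1) → k) :
    QuadraticMap.weightedSumSquares k w (hankelDiag a m x) =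
      ∑ i : Fin (2 * m + 1), ∑ j : Fin (2 * m + 1), a (i + j) * (x i * x j) := by
  set y := hankelDiag a m x with hy
  have hsum : QuadraticMap.weightedSumSquares k w y = ∑ i ∈ Finset.range (2 * m + 1),
      (if i = 0 then a (2 * m) else if Odd i then 1 else -1) * coordForm k _ i y ^ 2 := by
    rw [QuadraticMap.weightedSumSquares_apply, Finset.sum_range]
    refine Finset.sum_congr rfl fun i _ => ?_
    rw [coordForm_val, smul_eq_mul, sq]
    congr 1
    by_cases h : (i : ℕ) = 0
    · rw [if_pos h, ← hw0]
      exact congrArg w (Fin.ext h)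
    · rw [if_neg h, hw i (Nat.pos_of_ne_zero h)]
  rw [hsum, sum_coordForm_mul_hankelRow hchar ha, sum_range_two_mul_add_one, if_pos rfl, hy,
    coordForm_hankelDiag_zero]
  congr 1
  refine Finset.sum_congr rfl fun i hi => ?_
  have h : ¬ Odd (2 * i + 2) := by rw [Nat.not_odd_iff_even]; exact ⟨i + 1, by ring⟩
  rw [coordForm_hankelDiag_odd a (Finset.mem_range.1 hi),
    coordForm_hankelDiag_even a (Finset.mem_range.1 hi), if_neg (Nat.succ_ne_zero _),
    if_neg (Nat.succ_ne_zero _), if_pos (odd_two_mul_add_one i), if_neg h]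
  field_simp
  ring

end HankelForm


/-- Let `k` be a field of characteristic ≠ 2, `n` an odd positive integer,
and `A₁,…,Aₙ ∈ k` with `Aₙ ≠ 0`. Let `M` be the `n×n` symmetric matrix whose `(i,j)` entry
(1-based) is `A_{i+j-1}` if `i+j-1 ≤ n` and `0` otherwise. Then the quadratic form
`x ↦ xᵀMx` on `kⁿ` is equivalent to the diagonal form `⟨Aₙ, 1, -1, 1, -1, …, 1, -1⟩`. -/
theorem stmt_0 (k : Type*) [Field k] (hchar : (2 : k) ≠ 0)
    (n : ℕ) (hn : 1 ≤ n) (hodd : Odd n)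
    (A : Fin n → k) (hA : A ⟨n - 1, by omega⟩ ≠ 0)
    (M : Matrix (Fin n) (Fin n) k)
    (hM : ∀ i j : Fin n, M i j =
      if h : (i : ℕ) + (j : ℕ) < n then A ⟨(i : ℕ) + (j : ℕ), h⟩ else 0)
    (w : Fin n → k)
    (hw0 : w ⟨0, by omega⟩ = A ⟨n - 1, by omega⟩)
    (hw : ∀ i : Fin n, 0 < (i : ℕ) → w i = if Odd (i : ℕ) then 1 else -1) :
    QuadraticMap.Equivalent (Matrix.toQuadraticMap' M)
      (QuadraticMap.weightedSumSquares k w) := by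
  obtain ⟨m, rfl⟩ := hodd
  set a : ℕ → k := fun i => if h : i < 2 * m + 1 then A ⟨i, h⟩ else 0 with ha_def
  have ha (i : ℕ) (hi : 2 * m < i) : a i = 0 := dif_neg (by omega)
  have ham : a (2 * m) = A ⟨2 * m + 1 - 1, by omega⟩ := dif_pos (by omega)
  refine ⟨⟨LinearEquiv.ofInjectiveEndo (hankelDiag a m)
    (hankelDiag_injective hchar ha (ham ▸ hA)), fun x => ?_⟩⟩
  refine (weightedSumSquares_hankelDiag hchar ha (hw0.trans ham.symm) hw x).trans ?_
  change _ = Matrix.toLinearMap₂' k M x x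
  rw [Matrix.toLinearMap₂'_apply]
  refine Finset.sum_congr rfl fun i _ => Finset.sum_congr rfl fun j _ => ?_
  rw [hM]
  simp only [ha_def, smul_eq_mul]
  ring
end

section
/- Let k be a field of characteristic different from 2 and 3. Then the quadratic form on k⁴ determined by the symmetric matrix with rows (−729, 0, 0, 0), (0, 270, 36, 1), (0, 36, 1, 0), (0, 1, 0, 0) is equivalent to the orthogonal sum of two copies of the hyperbolic plane ⟨1,−1⟩, i.e., to the diagonal quadratic form ⟨1, −1, 1, −1⟩. (Equivalently, this Bézout matrix of the covering map X₀(3) → X(1) represents the class ⟨−729⟩ + 2⟨1⟩ + ⟨−1⟩ = 2(⟨1⟩ + ⟨−1⟩) in GW(k).) -/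
/-- Let `k` be a field of characteristic different from 2 and 3. The
quadratic form on `k⁴` determined by the symmetric matrix with rows `(-729,0,0,0)`,
`(0,270,36,1)`, `(0,36,1,0)`, `(0,1,0,0)` is equivalent to the orthogonal sum of two
copies of the hyperbolic plane, i.e. to the diagonal form `⟨1,-1,1,-1⟩`. -/
theorem stmt_8 (k : Type*) [Field k] (h2 : (2 : k) ≠ 0) (h3 : (3 : k) ≠ 0) :
    QuadraticMap.Equivalent
      (Matrix.toQuadraticMap'
        (!![-729, 0, 0, 0; 0, 270, 36, 1; 0, 36, 1, 0; 0, 1, 0, 0] : Matrix (Fin 4) (Fin 4) k))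
      (QuadraticMap.weightedSumSquares k ![(1 : k), -1, 1, -1]) := by
  change QuadraticMap.Equivalent (Matrix.toQuadraticForm' _) _
  have h27 : (27 : k) ≠ 0 := by
    rw [show (27 : k) = 3 ^ 3 by norm_num]
    exact pow_ne_zero 3 h3
  refine ⟨
    { toFun := fun x => ![x 2 + 36 * x 1, 27 * x 0, (x 3 - 511 * x 1) / 2, (x 3 - 515 * x 1) / 2]
      invFun := fun y => ![y 1 / 27, (y 2 - y 3) / 2, y 0 - 36 * ((y 2 - y 3) / 2),
        y 2 + y 3 + 513 * ((y 2 - y 3) / 2)]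
      map_add' := fun x y => by
        ext i
        fin_cases i <;> simp <;> ring
      map_smul' := fun c x => by
        ext i
        fin_cases i <;> simp <;> ring
      left_inv := fun x => by
        ext i
        fin_cases i <;> simp <;> field_simp <;> ring
      right_inv := fun y => by
        ext i
        fin_cases i <;> simp <;> field_simp <;> ring
      map_app' := fun x => ?_ }⟩
  simp [Matrix.toQuadraticForm', QuadraticMap.weightedSumSquares_apply,
    LinearMap.BilinMap.toQuadraticMap_apply, Matrix.toLinearMap₂'_apply, Fin.sum_univ_four]
  field_simp
  ring
end

section
/- Let k be a field of characteristic different from 2 and 5. Then the quadratic form on k⁶ determined by the symmetric matrix with rows (−125, 0, 0, 0, 0, 0), (0, 1575, 1300, 315, 30, 1), (0, 1300, 315, 30, 1, 0), (0, 315, 30, 1, 0, 0), (0, 30, 1, 0, 0, 0), (0, 1, 0, 0, 0, 0) is equivalent to the diagonal quadratic form ⟨1, 1, 1, −1, −1, −5⟩. (Equivalently, this Bézout matrix of the covering map X₀(5) → X(1) represents the class 3⟨1⟩ + 2⟨−1⟩ + ⟨−5⟩ in GW(k).) -/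
/-- The linear change of variables diagonalizing the Bézout form. -/
def bezoutDiagonalization {k : Type*} [Field k] (h2 : (2 : k) ≠ 0) (h5 : (5 : k) ≠ 0) :
    (Fin 6 → k) ≃ₗ[k] (Fin 6 → k) where
  toFun x :=
    ![x 3,
      x 1 + (x 5 + 30 * x 4 + 315 * x 3 + 1300 * x 2 + 1575 / 2 * x 1) / 2,
      x 2 + (x 4 + 30 * x 3 + 315 / 2 * x 2) / 2,
      x 1 - (x 5 + 30 * x 4 + 315 * x 3 + 1300 * x 2 + 1575 / 2 * x 1) / 2,
      x 2 - (x 4 + 30 * x 3 + 315 / 2 * x 2) / 2,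
      5 * x 0]
  invFun y :=
    ![y 5 / 5,
      (y 1 + y 3) / 2,
      (y 2 + y 4) / 2,
      y 0,
      y 2 - y 4 - 30 * y 0 - 315 / 2 * ((y 2 + y 4) / 2),
      y 1 - y 3 - 30 * (y 2 - y 4 - 30 * y 0 - 315 / 2 * ((y 2 + y 4) / 2)) - 315 * y 0
        - 1300 * ((y 2 + y 4) / 2) - 1575 / 2 * ((y 1 + y 3) / 2)]
  map_add' x y := by
    ext i
    fin_cases i <;> simp <;> ring
  map_smul' c x := by
    ext i
    fin_cases i <;> simp <;> ring
  left_inv x := by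
    ext i
    fin_cases i <;> simp <;> field_simp <;> ring
  right_inv y := by
    ext i
    fin_cases i <;> simp <;> field_simp <;> ring


/-- Let `k` be a field of characteristic different from 2 and 5. The
quadratic form on `k⁶` determined by the symmetric matrix with rows `(-125,0,0,0,0,0)`,
`(0,1575,1300,315,30,1)`, `(0,1300,315,30,1,0)`, `(0,315,30,1,0,0)`, `(0,30,1,0,0,0)`,
`(0,1,0,0,0,0)` is equivalent to the diagonal quadratic form `⟨1,1,1,-1,-1,-5⟩`. -/
theorem stmt_10 (k : Type*) [Field k] (h2 : (2 : k) ≠ 0) (h5 : (5 : k) ≠ 0) :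
    QuadraticMap.Equivalent
      (Matrix.toQuadraticMap'
        (!![-125, 0, 0, 0, 0, 0;
            0, 1575, 1300, 315, 30, 1;
            0, 1300, 315, 30, 1, 0;
            0, 315, 30, 1, 0, 0;
            0, 30, 1, 0, 0, 0;
            0, 1, 0, 0, 0, 0] : Matrix (Fin 6) (Fin 6) k))
      (QuadraticMap.weightedSumSquares k ![(1 : k), 1, 1, -1, -1, -5]) := by
  refine ⟨⟨bezoutDiagonalization h2 h5, fun x => ?_⟩⟩
  simp [bezoutDiagonalization, QuadraticMap.weightedSumSquares_apply, Matrix.toQuadraticMap',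
    Matrix.toQuadraticForm',
    LinearMap.BilinMap.toQuadraticMap_apply, Matrix.toLinearMap₂'_apply, Fin.sum_univ_succ]
  field_simp
  ring
end
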